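/- arXiv:1509.05994 — 4 statements merged into one kernel-verified Lean document; each statement's English description precedes it below -/
import Mathlib

section
/- For any irrational number ρ ∈ [0,1) there exists a C^∞, non-decreasing circle map f of degree one (i.e. with a C^∞ non-decreasing lift F : ℝ → ℝ satisfying F(x+1) = F(x)+1 for all x) and a non-degenerate arc U of the circle such that: (i) f(U) is a single point (F is constant on an interval of positive length); (ii) f has rotation number ρ; (iii) f is a Denjoy counterexample, i.e. f possesses a wandering interval: a non-empty open arc I such that the forward iterates f^n(I), n ≥ 0, are pairwise disjoint; in particular f is not topologically conjugate to the rigid rotation by ρ. -/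
open Filter Topology Set

namespace CircleDeg1Lift

/-- The translation number of `t + f` depends continuously on `t`. -/
theorem continuous_translationNumber_translate_mul (f : CircleDeg1Lift) (hf : Continuous f) :
    Continuous fun t : ℝ =>
      translationNumber (translate (Multiplicative.ofAdd t) * f : CircleDeg1Lift) := by
  set G : ℝ → CircleDeg1Lift := fun t => translate (Multiplicative.ofAdd t) * f with hG
  have hcont : ∀ n : ℕ, Continuous fun t => (G t ^ n) 0 := by
    intro n
    induction n with
    | zero => simpa using continuous_const
    | succ n ih =>
      have : (fun t => (G t ^ (n + 1)) 0) = fun t => t + f ((G t ^ n) 0) := by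
        funext t
        rw [pow_succ', mul_apply]
        simp [hG]
      rw [this]
      exact continuous_id.add (hf.comp ih)
  have hunif : TendstoUniformly (fun (n : ℕ) t => (G t ^ (n + 1)) 0 / ((n : ℝ) + 1))
      (fun t => translationNumber (G t)) atTop := by
    rw [Metric.tendstoUniformly_iff]
    intro ε hε
    filter_upwards [tendsto_one_div_add_atTop_nhds_zero_nat.eventually (gt_mem_nhds hε)]
      with n hn t
    refine lt_of_le_of_lt ?_ hn
    have h := (G t).dist_pow_map_zero_mul_translationNumber_le (n + 1)
    have hpos : (0 : ℝ) < n + 1 := by positivity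
    rw [dist_comm, Real.dist_eq] at h ⊢
    push_cast at h
    rw [le_div_iff₀ hpos, ← abs_of_pos hpos, ← abs_mul, abs_of_pos hpos, sub_mul,
      div_mul_cancel₀ _ hpos.ne', mul_comm (translationNumber _), abs_sub_comm]
    exact h
  exact hunif.continuous (Frequently.of_forall fun n => (hcont (n + 1)).div_const _)

/-- A continuous degree one lift vanishing at zero can be translated so as to have any prescribed
translation number in `[0, 1]`. -/
theorem exists_translationNumber_translate_mul_eq (f : CircleDeg1Lift) (hf : Continuous f)
    (hf0 : f 0 = 0) {ρ : ℝ} (hρ : ρ ∈ Icc (0 : ℝ) 1) :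
    ∃ t : ℝ, translationNumber (translate (Multiplicative.ofAdd t) * f : CircleDeg1Lift) = ρ := by
  have h : ∀ m : ℤ, translationNumber
      (translate (Multiplicative.ofAdd (m : ℝ)) * f : CircleDeg1Lift) = m := by
    intro m
    apply translationNumber_of_eq_add_int (x := 0)
    rw [mul_apply, translate_apply, hf0, add_comm]
  have h0 := h 0
  have h1 := h 1
  push_cast at h0 h1
  obtain ⟨t, -, ht⟩ := intermediate_value_Icc zero_le_one
    (f.continuous_translationNumber_translate_mul hf).continuousOn
    (show ρ ∈ Icc _ _ by rwa [h0, h1])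
  exact ⟨t, ht⟩

end CircleDeg1Lift

/-- A smooth monotone step from `0` to `1`, constant outside `(1 / 3, 2 / 3)`. -/
noncomputable def flatStep (x : ℝ) : ℝ := Real.smoothTransition (3 * x - 1)

theorem flatStep_of_le {x : ℝ} (hx : x ≤ 1 / 3) : flatStep x = 0 :=
  Real.smoothTransition.zero_of_nonpos (by linarith)

theorem flatStep_of_ge {x : ℝ} (hx : 2 / 3 ≤ x) : flatStep x = 1 :=
  Real.smoothTransition.one_of_one_le (by linarith)

theorem flatStep_monotone : Monotone flatStep := fun _ _ h =>
  Real.smoothTransition.monotone (by linarith)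

theorem contDiff_flatStep : ContDiff ℝ (⊤ : ℕ∞) flatStep :=
  Real.smoothTransition.contDiff.comp ((contDiff_const.mul contDiff_id).sub contDiff_const)

/-- The smooth staircase which is constant near the integers. -/
noncomputable def smoothStaircase (x : ℝ) : ℝ := ⌊x⌋ + flatStep (Int.fract x)

theorem smoothStaircase_eq (n : ℤ) {x : ℝ} (h₁ : n - 1 / 3 < x) (h₂ : x < n + 4 / 3) :
    smoothStaircase x = n + flatStep (x - n) := by
  rcases lt_or_ge x n with h | h
  · have hfl : ⌊x⌋ = n - 1 := by
      rw [Int.floor_eq_iff]; push_cast; constructor <;> linarith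
    rw [smoothStaircase, Int.fract, hfl]
    push_cast
    rw [flatStep_of_ge (by linarith), flatStep_of_le (by linarith)]
    ring
  rcases lt_or_ge x (n + 1) with h' | h'
  · have hfl : ⌊x⌋ = n := by
      rw [Int.floor_eq_iff]; constructor <;> linarith
    rw [smoothStaircase, Int.fract, hfl]
  · have hfl : ⌊x⌋ = n + 1 := by
      rw [Int.floor_eq_iff]; push_cast; constructor <;> linarith
    rw [smoothStaircase, Int.fract, hfl]
    push_cast
    rw [flatStep_of_ge (x := x - n) (by linarith), flatStep_of_le (by linarith)]
    ring

theorem contDiff_smoothStaircase : ContDiff ℝ (⊤ : ℕ∞) smoothStaircase := by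
  rw [contDiff_iff_contDiffAt]
  intro x
  have h₁ : (⌊x⌋ : ℝ) - 1 / 3 < x := by linarith [Int.floor_le x]
  have h₂ : x < (⌊x⌋ : ℝ) + 4 / 3 := by linarith [Int.lt_floor_add_one x]
  have hsm : ContDiff ℝ (⊤ : ℕ∞) fun y : ℝ => (⌊x⌋ : ℝ) + flatStep (y - ⌊x⌋) :=
    contDiff_const.add (contDiff_flatStep.comp (contDiff_id.sub contDiff_const))
  refine hsm.contDiffAt.congr_of_eventuallyEq ?_
  filter_upwards [Ioo_mem_nhds h₁ h₂] with y hy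
  exact smoothStaircase_eq _ hy.1 hy.2

theorem smoothStaircase_add_one (x : ℝ) : smoothStaircase (x + 1) = smoothStaircase x + 1 := by
  simp [smoothStaircase]
  ring

theorem smoothStaircase_monotone : Monotone smoothStaircase := by
  intro x y hxy
  rcases (Int.floor_mono hxy).eq_or_lt with h | h
  · have : Int.fract x ≤ Int.fract y := by
      rw [Int.fract, Int.fract, h]; linarith
    rw [smoothStaircase, smoothStaircase, h]
    linarith [flatStep_monotone this]
  · have h' : (⌊x⌋ : ℝ) + 1 ≤ ⌊y⌋ := by exact_mod_cast h
    have h₁ : flatStep (Int.fract x) ≤ 1 := Real.smoothTransition.le_one _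
    have h₂ : 0 ≤ flatStep (Int.fract y) := Real.smoothTransition.nonneg _
    rw [smoothStaircase, smoothStaircase]
    linarith

theorem smoothStaircase_of_mem {x : ℝ} (h₁ : -(1 / 3) < x) (h₂ : x ≤ 1 / 3) :
    smoothStaircase x = 0 := by
  rw [smoothStaircase_eq 0 (by simpa using h₁) (by push_cast; linarith),
    flatStep_of_le (by simpa using h₂)]
  simp

/-- `smoothStaircase` as a bundled degree one lift. -/
noncomputable def smoothStaircaseLift : CircleDeg1Lift :=
  ⟨⟨smoothStaircase, smoothStaircase_monotone⟩, smoothStaircase_add_one⟩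

/-- A circle map whose degree one lift has irrational translation number has no periodic points. -/
theorem CircleDeg1Lift.iterate_ne_self_of_irrational {G : CircleDeg1Lift}
    {f : AddCircle (1 : ℝ) → AddCircle (1 : ℝ)}
    (hf : ∀ x : ℝ, f (x : AddCircle (1 : ℝ)) = ((G x : ℝ) : AddCircle (1 : ℝ)))
    (hG : Irrational G.translationNumber) {k : ℕ} (hk : 0 < k) (p : AddCircle (1 : ℝ)) :
    f^[k] p ≠ p := by
  induction p using QuotientAddGroup.induction_on with
  | H x =>
    intro h
    have hsemi : Function.Semiconj (fun r : ℝ => (r : AddCircle (1 : ℝ))) G f :=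
      fun r => (hf r).symm
    have hx : (((G ^ k) x : ℝ) : AddCircle (1 : ℝ)) = x := by
      rw [G.coe_pow]
      exact ((hsemi.iterate_right k) x).trans h
    rw [← sub_eq_zero, ← AddCircle.coe_sub, AddCircle.coe_eq_zero_iff] at hx
    obtain ⟨m, hm⟩ := hx
    have hm' : (G ^ k) x = x + m := by
      simp only [zsmul_eq_mul, mul_one] at hm
      linarith
    have hrat := G.translationNumber_of_map_pow_eq_add_int hm' hk
    exact hG ⟨m / k, by rw [hrat]; push_cast; rfl⟩

/-- If a self-map without periodic points is constant on a set, then the forward iterates of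
that set are pairwise disjoint. -/
theorem disjoint_image_iterate_of_forall_eq {α : Type*} {f : α → α} {s : Set α}
    (hper : ∀ k : ℕ, 0 < k → ∀ p, f^[k] p ≠ p) (hs : ∀ x ∈ s, ∀ y ∈ s, f x = f y)
    {m n : ℕ} (hmn : m ≠ n) : Disjoint (f^[m] '' s) (f^[n] '' s) := by
  wlog hlt : m < n generalizing m n
  · exact (this hmn.symm (by omega)).symm
  rw [Set.disjoint_left]
  rintro _ ⟨x, hx, rfl⟩ ⟨y, hy, hxy⟩
  have hyx : f^[n] y = f^[n] x := by
    obtain ⟨l, rfl⟩ : ∃ l, n = l + 1 := ⟨n - 1, by omega⟩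
    rw [Function.iterate_succ_apply, Function.iterate_succ_apply, hs y hy x hx]
  refine hper (n - m) (by omega) (f^[m] x) ?_
  rw [← Function.iterate_add_apply, Nat.sub_add_cancel hlt.le, ← hyx, hxy]

/-- For any irrational `ρ ∈ [0,1)` there exists a `C^∞`, non-decreasing,
degree-one circle map `f` (given by a lift `F`) which is constant on an arc of positive
length, has rotation number `ρ`, and is a Denjoy counterexample: it has a wandering
interval and is not topologically conjugate to the rotation by `ρ`. -/
theorem cinfty_denjoy_counterexample_with_flat_interval
    (ρ : ℝ) (hρmem : ρ ∈ Set.Ico (0:ℝ) 1) (hρirr : Irrational ρ) :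
    ∃ (F : ℝ → ℝ) (f : AddCircle (1:ℝ) → AddCircle (1:ℝ)),
      -- `f` is C^∞, non-decreasing, of degree one, with lift `F`
      ContDiff ℝ (⊤ : ℕ∞) F ∧ Monotone F ∧ (∀ x : ℝ, F (x + 1) = F x + 1) ∧
      (∀ x : ℝ, f (x : AddCircle (1:ℝ)) = ((F x : ℝ) : AddCircle (1:ℝ))) ∧
      -- (i) there is a non-degenerate arc `U` on which `f` is constant
      (∃ a b : ℝ, a < b ∧ ∀ x ∈ Set.Ioo a b, ∀ y ∈ Set.Ioo a b, F x = F y) ∧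
      -- (ii) the rotation number of `f` is `ρ`
      (∀ x : ℝ, Tendsto (fun n : ℕ => F^[n] x / n) atTop (𝓝 ρ)) ∧
      -- (iii) `f` has a wandering interval: a non-empty open arc whose forward
      -- iterates are pairwise disjoint
      (∃ c d : ℝ, c < d ∧ ∀ m n : ℕ, m ≠ n →
        Disjoint (f^[m] '' ((fun r : ℝ => (r : AddCircle (1:ℝ))) '' Set.Ioo c d))
                 (f^[n] '' ((fun r : ℝ => (r : AddCircle (1:ℝ))) '' Set.Ioo c d))) ∧
      -- in particular `f` is not topologically conjugate to the rigid rotation by `ρ`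
      ¬ ∃ h : AddCircle (1:ℝ) ≃ₜ AddCircle (1:ℝ),
          ∀ θ : AddCircle (1:ℝ), h (f θ) = h θ + ((ρ : ℝ) : AddCircle (1:ℝ)) := by
  obtain ⟨t, ht⟩ := smoothStaircaseLift.exists_translationNumber_translate_mul_eq
    contDiff_smoothStaircase.continuous (smoothStaircase_of_mem (by norm_num) (by norm_num))
    (Ico_subset_Icc_self hρmem)
  set G : CircleDeg1Lift :=
    CircleDeg1Lift.translate (Multiplicative.ofAdd t) * smoothStaircaseLift with hGdef
  have hG : ∀ x, G x = t + smoothStaircase x := fun x => by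
    rw [hGdef, CircleDeg1Lift.mul_apply, CircleDeg1Lift.translate_apply]; rfl
  have hperiodic : Function.Periodic (fun x : ℝ => ((G x : ℝ) : AddCircle (1 : ℝ))) 1 :=
    fun x => by
      simp only [G.map_add_one]
      exact AddCircle.coe_add_period 1 _
  have hf : ∀ x : ℝ, hperiodic.lift (x : AddCircle (1 : ℝ)) = ((G x : ℝ) : AddCircle (1 : ℝ)) :=
    fun x => hperiodic.lift_coe x
  have hflat : ∀ x ∈ Ioo (0 : ℝ) (1 / 3), ∀ y ∈ Ioo (0 : ℝ) (1 / 3), G x = G y := by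
    intro x hx y hy
    rw [hG, hG, smoothStaircase_of_mem (by linarith [hx.1]) hx.2.le,
      smoothStaircase_of_mem (by linarith [hy.1]) hy.2.le]
  refine ⟨G, hperiodic.lift, ?_, G.monotone, G.map_add_one, hf,
    ⟨0, 1 / 3, by norm_num, hflat⟩, fun x => ?_, ⟨0, 1 / 3, by norm_num, fun m n hmn => ?_⟩, ?_⟩
  · rw [show (G : ℝ → ℝ) = fun x => t + smoothStaircase x from funext hG]
    exact contDiff_const.add contDiff_smoothStaircase
  · have h := (G.tendsto_translationNumber x).add (tendsto_const_div_atTop_nhds_zero_nat x)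
    rw [ht, add_zero] at h
    refine h.congr fun n => ?_
    rw [← G.coe_pow, ← add_div, sub_add_cancel]
  · refine disjoint_image_iterate_of_forall_eq
      (fun k hk p => CircleDeg1Lift.iterate_ne_self_of_irrational hf (ht ▸ hρirr) hk p) ?_ hmn
    rintro _ ⟨x, hx, rfl⟩ _ ⟨y, hy, rfl⟩
    simp only [hf, hflat x hx y hy]
  · rintro ⟨h, hh⟩
    have hval : hperiodic.lift ((1 / 6 : ℝ) : AddCircle (1 : ℝ)) =
        hperiodic.lift ((1 / 4 : ℝ) : AddCircle (1 : ℝ)) := by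
      rw [hf, hf, hflat (1 / 6) (by norm_num) (1 / 4) (by norm_num)]
    have heq := hh ((1 / 6 : ℝ) : AddCircle (1 : ℝ))
    rw [hval, hh] at heq
    have hcoe := h.injective (add_right_cancel heq)
    have : Fact ((0 : ℝ) < 1) := ⟨one_pos⟩
    rw [AddCircle.coe_eq_coe_iff_of_mem_Ico (a := 0) (by norm_num) (by norm_num)] at hcoe
    norm_num at hcoe
end

section
/- Let f₁, f₂ be continuous, non-decreasing, degree-one circle maps with lifts F₁, F₂. If F₁(x) < F₂(x) for all x ∈ ℝ, then τ(F₁) ≤ τ(F₂). Moreover, if τ(F₁) or τ(F₂) is irrational, then the inequality is strict: τ(F₁) < τ(F₂). -/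
open Filter Topology

namespace CircleDeg1Lift

/-- Two iterates of a point come arbitrarily close to each other modulo the integers. -/
theorem exists_pow_apply_close (f : CircleDeg1Lift) {δ : ℝ} (hδ : 0 < δ) :
    ∃ (y : ℝ) (n : ℕ) (m : ℤ), 0 < n ∧ |(f ^ n) y + m - y| < δ := by
  let u : ℕ → ℝ := fun i => (f ^ i) 0
  obtain ⟨K, hK⟩ := exists_nat_gt (1 / δ)
  have hK0 : (0 : ℝ) < K := (by positivity : (0 : ℝ) < 1 / δ).trans hK
  have hmem : ∀ i, ⌊K * Int.fract (u i)⌋ ∈ Set.Ico (0 : ℤ) K := fun i =>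
    ⟨Int.floor_nonneg.2 (mul_nonneg hK0.le (Int.fract_nonneg _)),
      Int.floor_lt.2 (by
        have := mul_lt_mul_of_pos_left (Int.fract_lt_one (u i)) hK0
        simpa using this)⟩
  have hpigeon : ∃ i j, i < j ∧ ⌊K * Int.fract (u i)⌋ = ⌊K * Int.fract (u j)⌋ := by
    obtain ⟨i, j, hij, h⟩ := Finite.exists_ne_map_eq_of_infinite
      (fun i => (⟨⌊K * Int.fract (u i)⌋, hmem i⟩ : Set.Ico (0 : ℤ) K))
    rcases hij.lt_or_gt with hlt | hlt
    · exact ⟨i, j, hlt, congrArg Subtype.val h⟩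
    · exact ⟨j, i, hlt, (congrArg Subtype.val h).symm⟩
  obtain ⟨i, j, hij, h⟩ := hpigeon
  refine ⟨u i, j - i, ⌊u i⌋ - ⌊u j⌋, Nat.sub_pos_of_lt hij, ?_⟩
  have hj : (f ^ (j - i)) (u i) = u j := by
    change (f ^ (j - i) * f ^ i) 0 = (f ^ j) 0
    rw [← pow_add, Nat.sub_add_cancel hij.le]
  have habs := Int.abs_sub_lt_one_of_floor_eq_floor h.symm
  rw [← mul_sub, abs_mul, abs_of_pos hK0] at habs
  have hfract : (f ^ (j - i)) (u i) + ((⌊u i⌋ - ⌊u j⌋ : ℤ) : ℝ) - u i =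
      Int.fract (u j) - Int.fract (u i) := by
    rw [hj, Int.fract, Int.fract]
    push_cast
    ring
  rw [hfract]
  rw [div_lt_iff₀ hδ] at hK
  exact lt_of_mul_lt_mul_left (habs.trans hK) hK0.le

/-- Positive values of `p * a + q` with `p` large are arbitrarily small, for `a` irrational;
the bound is itself of the form `n * a + m`. -/
theorem _root_.Irrational.exists_nat_mul_add_int_mem_Ioo {a : ℝ} (ha : Irrational a) (n : ℕ)
    (m : ℤ) (h : 0 < n * a + m) :
    ∃ (p : ℕ) (q : ℤ), n < p ∧ 0 < p * a + q ∧ p * a + q < n * a + m := by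
  obtain ⟨N, hN⟩ := exists_nat_one_div_lt h
  obtain ⟨j, k, hk, -, hjk⟩ :=
    Real.exists_int_int_abs_mul_sub_le (((n + 1 : ℕ) : ℝ) * a) N.succ_pos
  lift k to ℕ using hk.le
  have hk' : 0 < k := by exact_mod_cast hk
  set η : ℝ := ((k * (n + 1) : ℕ) : ℝ) * a - j with hη
  have hη_lt : |η| < n * a + m := by
    refine lt_of_le_of_lt ?_ hN
    have hN' : (1 : ℝ) / ((N.succ : ℝ) + 1) ≤ 1 / (N + 1) := by
      gcongr
      simp
    refine le_trans (le_of_eq ?_) (hjk.trans hN')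
    rw [hη]
    push_cast
    ring_nf
  have hη_ne : η ≠ 0 := ((ha.natCast_mul (by positivity)).sub_intCast j).ne_zero
  have hη_abs := abs_lt.1 hη_lt
  rcases hη_ne.lt_or_gt with hneg | hpos
  · refine ⟨n + k * (n + 1), m - j, by nlinarith, ?_, ?_⟩ <;> push_cast at hη ⊢ <;> linarith
  · refine ⟨k * (n + 1), -j, by nlinarith, ?_, ?_⟩ <;> push_cast at hη ⊢ <;> linarith

/-- If the translation number is irrational, some point returns modulo the integers arbitrarily
close to itself on its left. -/
theorem exists_pow_apply_mem_Ioc_of_irrational (f : CircleDeg1Lift)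
    (hf : Irrational f.translationNumber) {δ : ℝ} (hδ : 0 < δ) :
    ∃ (x : ℝ) (n : ℕ) (m : ℤ), 0 < n ∧ (f ^ n) x ∈ Set.Ioc (x + m - δ) (x + m) := by
  obtain ⟨y, n, m, hn, hy⟩ := f.exists_pow_apply_close hδ
  have hy := abs_lt.1 hy
  rcases le_or_gt ((f ^ n) y + m) y with hle | hgt
  · refine ⟨y, n, -m, hn, ?_, ?_⟩ <;> push_cast <;> linarith
  have hpos : 0 < n * f.translationNumber + m := by
    have hge : ((-m : ℤ) : ℝ) ≤ (f ^ n).translationNumber :=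
      (f ^ n).le_translationNumber_of_add_int_le (x := y) (by push_cast; linarith)
    rw [translationNumber_pow] at hge
    have hne : n * f.translationNumber + m ≠ 0 := ((hf.natCast_mul hn.ne').add_intCast m).ne_zero
    push_cast at hge
    exact lt_of_le_of_ne (by linarith) hne.symm
  obtain ⟨p, q, hnp, hp0, hp1⟩ := hf.exists_nat_mul_add_int_mem_Ioo n m hpos
  refine ⟨(f ^ n) y, p - n, m - q, Nat.sub_pos_of_lt hnp, ?_, ?_⟩
  · have hmul : (f ^ (p - n)) ((f ^ n) y) = (f ^ p) y := by
      rw [← mul_apply, ← pow_add, Nat.sub_add_cancel hnp.le]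
    have hlt := (f ^ p).lt_map_of_int_lt_translationNumber (n := -q)
      (by rw [translationNumber_pow]; push_cast; linarith) y
    rw [hmul]
    push_cast at hlt ⊢
    linarith
  · refine ((f ^ (p - n)).map_lt_of_translationNumber_lt_int ?_ _).le
    rw [translationNumber_pow, Nat.cast_sub hnp.le]
    push_cast
    linarith

/-- A strict inequality between continuous lifts is uniform. -/
theorem exists_pos_forall_add_le {f g : CircleDeg1Lift} (hf : Continuous f) (hg : Continuous g)
    (h : ∀ x, f x < g x) : ∃ δ > 0, ∀ x, f x + δ ≤ g x := by
  obtain ⟨z, -, hz⟩ := isCompact_Icc.exists_isMinOn (Set.nonempty_Icc.2 (zero_le_one' ℝ))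
    (hg.sub hf).continuousOn
  refine ⟨g z - f z, sub_pos.2 (h z), fun x => ?_⟩
  have hx : g z - f z ≤ g (Int.fract x) - f (Int.fract x) :=
    hz ⟨Int.fract_nonneg x, (Int.fract_lt_one x).le⟩
  linarith [f.map_fract_sub_fract_eq x, g.map_fract_sub_fract_eq x]

theorem translationNumber_ne_of_forall_add_le {f g : CircleDeg1Lift} {δ : ℝ} (hδ : 0 < δ)
    (h : ∀ x, f x + δ ≤ g x) (hf : Irrational f.translationNumber) :
    f.translationNumber ≠ g.translationNumber := by
  intro heq
  obtain ⟨x, n, m, hn, hlow, hupp⟩ := f.exists_pow_apply_mem_Ioc_of_irrational hf hδ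
  have hfg : f ≤ g := fun x => by linarith [h x]
  have hstep : (f ^ n) x + δ ≤ (g ^ n) x := by
    obtain ⟨k, rfl⟩ := Nat.exists_eq_add_one_of_ne_zero hn.ne'
    rw [pow_succ', pow_succ', mul_apply, mul_apply]
    exact (h _).trans (g.monotone (pow_mono hfg k x))
  have hle := (f ^ n).translationNumber_le_of_le_add_int hupp
  have hge := (g ^ n).le_translationNumber_of_add_int_le (x := x) (m := m) (by linarith)
  rw [translationNumber_pow] at hle hge
  rw [← heq] at hge
  exact (hf.natCast_mul hn.ne').ne_int m (le_antisymm hle hge)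

end CircleDeg1Lift

/-- Let `f₁, f₂` be continuous, non-decreasing, degree-one circle maps
with lifts `F₁, F₂`. If `F₁ x < F₂ x` for all `x`, then `τ(F₁) ≤ τ(F₂)`; moreover if
`τ(F₁)` or `τ(F₂)` is irrational, then `τ(F₁) < τ(F₂)`. -/
theorem translation_number_monotone
    (F₁ F₂ : CircleDeg1Lift) (hc₁ : Continuous F₁) (hc₂ : Continuous F₂)
    (hlt : ∀ x : ℝ, F₁ x < F₂ x) :
    F₁.translationNumber ≤ F₂.translationNumber ∧
    ((Irrational F₁.translationNumber ∨ Irrational F₂.translationNumber) →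
      F₁.translationNumber < F₂.translationNumber) := by
  have hle : F₁.translationNumber ≤ F₂.translationNumber :=
    CircleDeg1Lift.translationNumber_mono fun x => (hlt x).le
  refine ⟨hle, fun hirr => lt_of_le_of_ne hle fun heq => ?_⟩
  rw [← heq, or_self] at hirr
  obtain ⟨δ, hδ, h⟩ := CircleDeg1Lift.exists_pos_forall_add_le hc₁ hc₂ hlt
  exact CircleDeg1Lift.translationNumber_ne_of_forall_add_le hδ h hirr heq
end

section
/- Let f : S¹ → S¹ be a continuous, non-decreasing, degree-one circle map with irrational rotation number ρ ∈ [0,1). Then the following statements are equivalent: (1) f is a Denjoy counterexample (f is not topologically conjugate to the rigid rotation R_ρ); (2) f has no dense orbit, i.e. there is no x ∈ S¹ whose forward orbit {f^n(x) : n ≥ 0} is dense in S¹; (3) f has a wandering interval, i.e. there exists a non-empty open arc I ⊂ S¹ whose forward iterates f^n(I), n ≥ 0, are pairwise disjoint; (4) there exists an arc I ⊂ S¹ with |I| > 0 such that |f^n(I)| → 0 as n → +∞, where |·| denotes arc length. -/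
open Filter Topology Set

theorem Irrational.denseRange_nsmul_coe {ρ : ℝ} (hρ : Irrational ρ) :
    DenseRange (fun n : ℕ => n • (ρ : AddCircle (1 : ℝ))) :=
  denseRange_zsmul_iff_nsmul.1 (AddCircle.denseRange_zsmul_coe_iff.2 (by simpa using hρ))

theorem Irrational.injective_nsmul_coe {ρ : ℝ} (hρ : Irrational ρ) :
    Function.Injective (fun n : ℕ => n • (ρ : AddCircle (1 : ℝ))) := by
  rw [injective_nsmul_iff_not_isOfFinAddOrder, ← addOrderOf_eq_zero_iff]
  exact AddCircle.denseRange_zsmul_iff.1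
    (AddCircle.denseRange_zsmul_coe_iff.2 (by simpa using hρ))

namespace CircleDeg1Lift

theorem abs_iterate_sub_mul_translationNumber_le (g : CircleDeg1Lift) (x : ℝ) (n : ℕ) :
    |g^[n] x - n * g.translationNumber| ≤ |x| + 2 := by
  have h0 := g.dist_pow_map_zero_mul_translationNumber_le n
  have h1 := (g ^ n).map_le_of_map_zero x
  have h2 := (g ^ n).le_map_of_map_zero x
  rw [Real.dist_eq, abs_le] at h0
  rw [coe_pow] at h0 h1 h2
  have h3 := Int.ceil_lt_add_one x
  have h4 := Int.sub_one_lt_floor x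
  rw [abs_le]
  constructor <;> linarith [neg_abs_le x, le_abs_self x]

/-- A degree one lift with irrational translation number is semiconjugate, by a continuous degree
one lift, to the corresponding translation. -/
theorem exists_continuous_semiconj_add_translationNumber (g : CircleDeg1Lift)
    (hg : Irrational g.translationNumber) :
    ∃ h : CircleDeg1Lift, Continuous h ∧ ∀ x, h (g x) = h x + g.translationNumber := by
  set τ := g.translationNumber with hτ
  let u : ℝ → ℕ → ℝ := fun x n => g^[n] x - n * τ
  have hu : ∀ x n, |u x n| ≤ |x| + 2 := g.abs_iterate_sub_mul_translationNumber_le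
  have hbdd : ∀ x, IsBoundedUnder (· ≤ ·) atTop (u x) := fun x =>
    isBoundedUnder_of ⟨|x| + 2, fun n => (abs_le.1 (hu x n)).2⟩
  have hcobdd : ∀ x, IsCoboundedUnder (· ≤ ·) atTop (u x) := fun x =>
    IsBoundedUnder.isCoboundedUnder_le
      (isBoundedUnder_of ⟨-(|x| + 2), fun n => (abs_le.1 (hu x n)).1⟩)
  let h : CircleDeg1Lift :=
    { toFun := fun x => limsup (u x) atTop
      monotone' := fun x y hxy => limsup_le_limsup
        (Eventually.of_forall fun n => sub_le_sub_right (g.monotone.iterate n hxy) _)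
        (hcobdd x) (hbdd y)
      map_add_one' := fun x => by
        rw [← limsup_add_const atTop (u x) 1 (hbdd x) (hcobdd x)]
        congr 1
        funext n
        have := (g ^ n).map_add_one x
        rw [coe_pow] at this
        simp only [u, this]
        ring }
  have hsemi : ∀ x, h (g x) = h x + τ := fun x => by
    change limsup (u (g x)) atTop = limsup (u x) atTop + τ
    rw [← limsup_nat_add (u x) 1, ← limsup_add_const atTop (fun n => u x (n + 1)) τ]
    · congr 1
      funext n
      simp only [u, Function.iterate_succ_apply]
      push_cast
      ring
    · exact isBoundedUnder_of ⟨|x| + 2, fun n => (abs_le.1 (hu x (n + 1))).2⟩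
    · exact IsBoundedUnder.isCoboundedUnder_le
        (isBoundedUnder_of ⟨-(|x| + 2), fun n => (abs_le.1 (hu x (n + 1))).1⟩)
  refine ⟨h, h.monotone.continuous_of_denseRange ?_, hsemi⟩
  have hiter : ∀ n : ℕ, h (g^[n] 0) = h 0 + n * τ := fun n => by
    induction n with
    | zero => simp
    | succ n ih =>
      rw [Function.iterate_succ_apply', hsemi, ih]
      push_cast
      ring
  have hd : DenseRange (fun n : ℕ => (h 0 : AddCircle (1 : ℝ)) + n • (τ : AddCircle (1 : ℝ))) :=
    (Homeomorph.addLeft (h 0 : AddCircle (1 : ℝ))).surjective.denseRange.comp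
      hg.denseRange_nsmul_coe (Homeomorph.addLeft _).continuous
  refine (QuotientAddGroup.dense_preimage_mk.2 hd).mono ?_
  rintro y ⟨n, hn⟩
  have hn' : ((y - (h 0 + n * τ) : ℝ) : AddCircle (1 : ℝ)) = 0 := by
    rw [AddCircle.coe_sub, sub_eq_zero, AddCircle.coe_add, ← nsmul_eq_mul, AddCircle.coe_nsmul]
    exact hn.symm
  obtain ⟨m, hm⟩ := (AddCircle.coe_eq_zero_iff _).1 hn'
  refine ⟨g^[n] 0 + m, ?_⟩
  rw [h.map_add_int, hiter]
  simp at hm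
  linarith

theorem coe_apply_eq_coe_iff {h : CircleDeg1Lift} (hinj : Function.Injective h) {x y : ℝ} :
    (h x : AddCircle (1 : ℝ)) = h y ↔ (x : AddCircle (1 : ℝ)) = y := by
  rw [← sub_eq_zero, ← AddCircle.coe_sub, AddCircle.coe_eq_zero_iff,
    ← sub_eq_zero (a := (x : AddCircle (1 : ℝ))),
    ← AddCircle.coe_sub, AddCircle.coe_eq_zero_iff]
  refine exists_congr fun m => ?_
  simp only [zsmul_eq_mul, mul_one, eq_sub_iff_add_eq']
  rw [← h.map_add_int, hinj.eq_iff]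

theorem periodic_coe (h : CircleDeg1Lift) :
    Function.Periodic (fun x => (h x : AddCircle (1 : ℝ))) 1 := fun x => by
  simp

/-- A continuous injective degree one lift induces a homeomorphism of the circle. -/
theorem exists_homeomorph_of_injective {h : CircleDeg1Lift} (hc : Continuous h)
    (hinj : Function.Injective h) :
    ∃ e : AddCircle (1 : ℝ) ≃ₜ AddCircle (1 : ℝ), ∀ x : ℝ, e x = h x := by
  have hcont : Continuous h.periodic_coe.lift :=
    continuous_coinduced_dom.2 ((AddCircle.continuous_mk' 1).comp hc)
  have hbij : Function.Bijective h.periodic_coe.lift := by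
    constructor
    · intro θ θ'
      induction θ using QuotientAddGroup.induction_on
      induction θ' using QuotientAddGroup.induction_on
      exact (coe_apply_eq_coe_iff hinj).1
    · intro θ
      induction θ using QuotientAddGroup.induction_on with
      | H y =>
        obtain ⟨x, rfl⟩ := h.continuous_iff_surjective.1 hc y
        exact ⟨x, rfl⟩
  exact ⟨Continuous.homeoOfEquivCompactToT2 (f := Equiv.ofBijective _ hbij) hcont, fun x => rfl⟩

/-- Displacements of a continuous degree one lift over short intervals are uniformly small. -/
theorem exists_forall_sub_lt {h : CircleDeg1Lift} (hc : Continuous h) {δ : ℝ} (hδ : 0 < δ) :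
    ∃ ε > 0, ∀ u v : ℝ, u ≤ v → v - u < ε → h v - h u < δ := by
  obtain ⟨ε, hε, H⟩ := Metric.uniformContinuousOn_iff.1
    ((isCompact_Icc (a := (0 : ℝ)) (b := 2)).uniformContinuousOn_of_continuous hc.continuousOn)
    δ hδ
  refine ⟨min ε 1, by positivity, fun u v huv hlt => ?_⟩
  have h1 := Int.floor_le u
  have h2 := Int.lt_floor_add_one u
  have h3 := min_le_left ε 1
  have h4 := min_le_right ε 1
  have := H (v - ⌊u⌋) ⟨by linarith, by linarith⟩ (u - ⌊u⌋) ⟨by linarith, by linarith⟩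
    (by rw [Real.dist_eq, abs_lt]; constructor <;> linarith)
  rw [h.map_sub_int, h.map_sub_int, Real.dist_eq] at this
  linarith [le_abs_self (h v - ⌊u⌋ - (h u - ⌊u⌋))]

end CircleDeg1Lift

theorem AddCircle.ofReal_min_le_volume_image_Ioo (u v : ℝ) :
    ENNReal.ofReal (min (v - u) 1) ≤
      MeasureTheory.volume ((fun r : ℝ => (r : AddCircle (1 : ℝ))) '' Ioo u v) := by
  have hmp := AddCircle.measurePreserving_mk (1 : ℝ) u
  rw [← hmp.map_eq]
  refine le_trans ?_ (MeasureTheory.Measure.le_map_apply hmp.measurable.aemeasurable _)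
  have hsub : Ioo u (min v (u + 1)) ⊆ Ioc u (u + 1) := fun x hx =>
    ⟨hx.1, (hx.2.trans_le (min_le_right _ _)).le⟩
  calc ENNReal.ofReal (min (v - u) 1)
      = MeasureTheory.volume.restrict (Ioc u (u + 1)) (Ioo u (min v (u + 1))) := by
        rw [MeasureTheory.Measure.restrict_apply measurableSet_Ioo,
          inter_eq_left.2 hsub,
          Real.volume_Ioo, ← min_sub_sub_right, add_sub_cancel_left]
    _ ≤ _ := by
        refine MeasureTheory.measure_mono fun x hx => ?_
        exact ⟨x, ⟨hx.1, hx.2.trans_le (min_le_left _ _)⟩, rfl⟩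

theorem measurableSet_image_Ioo_of_continuous {X : Type*} [TopologicalSpace X] [T2Space X]
    [MeasurableSpace X] [OpensMeasurableSpace X] {φ : ℝ → X} (hφ : Continuous φ) (c d : ℝ) :
    MeasurableSet (φ '' Ioo c d) := by
  obtain ⟨K, hK, hKsub, hU, -⟩ := (isOpen_Ioo (a := c) (b := d)).exists_iUnion_isClosed
  rw [← hU, image_iUnion]
  exact MeasurableSet.iUnion fun n => ((isCompact_Icc.of_isClosed_subset (hK n)
    ((hKsub n).trans Ioo_subset_Icc_self)).image hφ).measurableSet

theorem MeasureTheory.tendsto_measure_zero_of_pairwise_disjoint {X : Type*} [MeasurableSpace X]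
    {μ : Measure X} [IsFiniteMeasure μ] {s : ℕ → Set X} (hs : ∀ n, MeasurableSet (s n))
    (hd : Pairwise (Function.onFun Disjoint s)) : Tendsto (fun n => μ (s n)) atTop (𝓝 0) :=
  ENNReal.tendsto_atTop_zero_of_tsum_ne_top
    ((tsum_meas_le_meas_iUnion_of_disjoint μ hs hd).trans_lt (measure_lt_top μ _)).ne

/-- For a continuous, non-decreasing, degree-one circle map `f` with
irrational rotation number `ρ ∈ [0,1)`, the following are equivalent:
(1) `f` is a Denjoy counterexample (not topologically conjugate to the rotation `R_ρ`);
(2) `f` has no dense (forward) orbit;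
(3) `f` has a wandering interval;
(4) there is an arc `I` of positive length with `|f^n(I)| → 0`. -/
theorem denjoy_counterexample_tfae
    (f : AddCircle (1:ℝ) → AddCircle (1:ℝ)) (F : ℝ → ℝ) (ρ : ℝ)
    (hmono : Monotone F) (hcont : Continuous F)
    (hdeg : ∀ x : ℝ, F (x + 1) = F x + 1)
    (hlift : ∀ x : ℝ, f (x : AddCircle (1:ℝ)) = ((F x : ℝ) : AddCircle (1:ℝ)))
    (hρmem : ρ ∈ Set.Ico (0:ℝ) 1) (hρirr : Irrational ρ)
    (hrot : ∀ x : ℝ, Tendsto (fun n : ℕ => F^[n] x / n) atTop (𝓝 ρ)) :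
    List.TFAE
      [ -- (1) `f` is not topologically conjugate to the rigid rotation by `ρ`
        ¬ ∃ h : AddCircle (1:ℝ) ≃ₜ AddCircle (1:ℝ),
            ∀ θ : AddCircle (1:ℝ), h (f θ) = h θ + ((ρ : ℝ) : AddCircle (1:ℝ)),
        -- (2) no point has a dense forward orbit
        ¬ ∃ x : AddCircle (1:ℝ), Dense (Set.range fun n : ℕ => f^[n] x),
        -- (3) `f` has a wandering interval
        ∃ c d : ℝ, c < d ∧ ∀ m n : ℕ, m ≠ n →
          Disjoint (f^[m] '' ((fun r : ℝ => (r : AddCircle (1:ℝ))) '' Set.Ioo c d))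
                   (f^[n] '' ((fun r : ℝ => (r : AddCircle (1:ℝ))) '' Set.Ioo c d)),
        -- (4) some arc of positive length has iterates of length tending to `0`
        ∃ c d : ℝ, c < d ∧
          Tendsto
            (fun n : ℕ => MeasureTheory.volume
              (f^[n] '' ((fun r : ℝ => (r : AddCircle (1:ℝ))) '' Set.Ioo c d)))
            atTop (𝓝 0) ] := by
  let g : CircleDeg1Lift := ⟨⟨F, hmono⟩, hdeg⟩
  have hτ : g.translationNumber = ρ :=
    tendsto_nhds_unique
      (by simpa only [CircleDeg1Lift.coe_pow] using! g.tendsto_translation_number₀) (hrot 0)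
  obtain ⟨h, hc, hsemi⟩ := g.exists_continuous_semiconj_add_translationNumber (hτ ▸ hρirr)
  replace hsemi : ∀ x, h (F x) = h x + ρ := hτ ▸ hsemi
  have hFiter : ∀ (n : ℕ) (x : ℝ), f^[n] (x : AddCircle (1 : ℝ)) = (F^[n] x : ℝ) := fun n x =>
    ((Function.Semiconj.iterate_right (f := fun r : ℝ => (r : AddCircle (1 : ℝ)))
      (fun r => (hlift r).symm) n) x).symm
  have hiter : ∀ (n : ℕ) (x : ℝ), h (F^[n] x) = h x + n * ρ := fun n x => by
    induction n with
    | zero => simp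
    | succ n ih =>
      rw [Function.iterate_succ_apply', hsemi, ih]
      push_cast
      ring
  let H : AddCircle (1 : ℝ) → AddCircle (1 : ℝ) := h.periodic_coe.lift
  have hH : ∀ x : ℝ, H x = h x := fun x => rfl
  have hHiter : ∀ (n : ℕ) (θ : AddCircle (1 : ℝ)),
      H (f^[n] θ) = H θ + n • (ρ : AddCircle (1 : ℝ)) := fun n θ => by
    induction θ using QuotientAddGroup.induction_on with
    | H x => rw [hFiter, hH, hH, hiter, AddCircle.coe_add, ← nsmul_eq_mul, AddCircle.coe_nsmul]
  have hplateau : ∀ {a b t : ℝ}, h a = h b → t ∈ Ioo a b → h t = h a := fun hab ht =>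
    le_antisymm (hab ▸ h.monotone ht.2.le) (h.monotone ht.1.le)
  have h1A : (¬ ∃ k : AddCircle (1:ℝ) ≃ₜ AddCircle (1:ℝ),
      ∀ θ : AddCircle (1:ℝ), k (f θ) = k θ + ((ρ : ℝ) : AddCircle (1:ℝ))) →
      ∃ a b, a < b ∧ h a = h b := by
    contrapose!
    intro hne
    have hinj : Function.Injective h := fun a b hab => by
      by_contra hn
      rcases lt_or_gt_of_ne hn with hl | hl
      · exact hne a b hl hab
      · exact hne b a hl hab.symm
    obtain ⟨k, hk⟩ := CircleDeg1Lift.exists_homeomorph_of_injective hc hinj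
    refine ⟨k, fun θ => ?_⟩
    induction θ using QuotientAddGroup.induction_on with
    | H x => rw [hlift, hk, hk, hsemi, AddCircle.coe_add]
  have hA2 : (∃ a b, a < b ∧ h a = h b) →
      ¬ ∃ x : AddCircle (1:ℝ), Dense (Set.range fun n : ℕ => f^[n] x) := by
    rintro ⟨a, b, hab, heq⟩ ⟨x, hx⟩
    set J : Set (AddCircle (1 : ℝ)) := (fun r : ℝ => (r : AddCircle (1 : ℝ))) '' Ioo a b with hJ
    have hJo : IsOpen J := QuotientAddGroup.isOpenMap_coe _ isOpen_Ioo
    have hHJ : ∀ θ ∈ J, H θ = h a := by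
      rintro _ ⟨t, ht, rfl⟩
      exact congrArg _ (hplateau heq ht)
    obtain ⟨_, ⟨m, rfl⟩, hm⟩ := hx.exists_mem_open hJo ((nonempty_Ioo.2 hab).image _)
    have hJ' : (J \ {f^[m] x}).Nonempty := by
      obtain ⟨s, hs, hsm⟩ := id hm
      obtain ⟨t, hst, ht⟩ := exists_between (lt_min hs.2 (lt_add_one s))
      refine ⟨t, ⟨t, ⟨hs.1.trans hst, ht.trans_le (min_le_left _ _)⟩, rfl⟩, fun hts => ?_⟩
      refine hst.ne' ((AddCircle.coe_eq_coe_iff_of_mem_Ico (p := 1) (a := s)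
        ⟨hst.le, ht.trans_le (min_le_right _ _)⟩ ⟨le_rfl, lt_add_one s⟩).1 ?_)
      exact (mem_singleton_iff.1 hts).trans hsm.symm
    obtain ⟨_, ⟨n, rfl⟩, hn⟩ := hx.exists_mem_open (hJo.sdiff isClosed_singleton) hJ'
    have hmn := (hHJ _ hm).trans (hHJ _ hn.1).symm
    rw [hHiter, hHiter] at hmn
    have := hρirr.injective_nsmul_coe (add_left_cancel hmn)
    subst this
    exact hn.2 rfl
  have h21 : (¬ ∃ x : AddCircle (1:ℝ), Dense (Set.range fun n : ℕ => f^[n] x)) →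
      ¬ ∃ k : AddCircle (1:ℝ) ≃ₜ AddCircle (1:ℝ),
        ∀ θ : AddCircle (1:ℝ), k (f θ) = k θ + ((ρ : ℝ) : AddCircle (1:ℝ)) := by
    rintro hno ⟨k, hk⟩
    refine hno ⟨k.symm 0, ?_⟩
    have horb : (fun n : ℕ => f^[n] (k.symm 0)) =
        k.symm ∘ fun n : ℕ => n • (ρ : AddCircle (1 : ℝ)) := by
      funext n
      rw [Function.comp_apply, Homeomorph.eq_symm_apply]
      induction n with
      | zero => simp
      | succ n ih => rw [Function.iterate_succ_apply', hk, ih, succ_nsmul]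
    rw [horb]
    exact k.symm.surjective.denseRange.comp hρirr.denseRange_nsmul_coe k.symm.continuous
  have hA3 : (∃ a b, a < b ∧ h a = h b) → ∃ c d : ℝ, c < d ∧ ∀ m n : ℕ, m ≠ n →
      Disjoint (f^[m] '' ((fun r : ℝ => (r : AddCircle (1:ℝ))) '' Set.Ioo c d))
        (f^[n] '' ((fun r : ℝ => (r : AddCircle (1:ℝ))) '' Set.Ioo c d)) := by
    rintro ⟨a, b, hab, heq⟩
    refine ⟨a, b, hab, fun m n hmn => Set.disjoint_left.2 ?_⟩
    rintro _ ⟨_, ⟨s, hs, rfl⟩, rfl⟩ ⟨_, ⟨t, ht, rfl⟩, hst⟩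
    have := congrArg H hst
    rw [hHiter, hHiter, hH, hH, hplateau heq hs, hplateau heq ht] at this
    exact hmn (hρirr.injective_nsmul_coe (add_left_cancel this)).symm
  have himage : ∀ (n : ℕ) (c d : ℝ),
      f^[n] '' ((fun r : ℝ => (r : AddCircle (1:ℝ))) '' Ioo c d) =
        (fun r : ℝ => (F^[n] r : AddCircle (1 : ℝ))) '' Ioo c d := fun n c d => by
    rw [image_image]
    exact image_congr fun r _ => hFiter n r
  have h34 : (∃ c d : ℝ, c < d ∧ ∀ m n : ℕ, m ≠ n →
      Disjoint (f^[m] '' ((fun r : ℝ => (r : AddCircle (1:ℝ))) '' Set.Ioo c d))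
        (f^[n] '' ((fun r : ℝ => (r : AddCircle (1:ℝ))) '' Set.Ioo c d))) →
      ∃ c d : ℝ, c < d ∧ Tendsto (fun n : ℕ => MeasureTheory.volume
        (f^[n] '' ((fun r : ℝ => (r : AddCircle (1:ℝ))) '' Set.Ioo c d))) atTop (𝓝 0) := by
    rintro ⟨c, d, hcd, hdis⟩
    refine ⟨c, d, hcd, MeasureTheory.tendsto_measure_zero_of_pairwise_disjoint (fun n => ?_)
      fun m n hmn => hdis m n hmn⟩
    rw [himage]
    exact measurableSet_image_Ioo_of_continuous
      ((AddCircle.continuous_mk' 1).comp (hcont.iterate n)) c d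
  have h4A : (∃ c d : ℝ, c < d ∧ Tendsto (fun n : ℕ => MeasureTheory.volume
        (f^[n] '' ((fun r : ℝ => (r : AddCircle (1:ℝ))) '' Set.Ioo c d))) atTop (𝓝 0)) →
      ∃ a b, a < b ∧ h a = h b := by
    rintro ⟨c, d, hcd, hlim⟩
    refine ⟨c, d, hcd, ?_⟩
    by_contra hne
    have hlt : 0 < h d - h c := sub_pos.2 ((h.monotone hcd.le).lt_of_ne hne)
    obtain ⟨ε, hε, hsmall⟩ := CircleDeg1Lift.exists_forall_sub_lt hc hlt
    obtain ⟨n, hn⟩ := (hlim.eventually_lt_const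
      (ENNReal.ofReal_pos.2 (lt_min hε one_pos))).exists
    have hlow : ENNReal.ofReal (min (F^[n] d - F^[n] c) 1) ≤ MeasureTheory.volume
        (f^[n] '' ((fun r : ℝ => (r : AddCircle (1:ℝ))) '' Set.Ioo c d)) := by
      refine (AddCircle.ofReal_min_le_volume_image_Ioo _ _).trans (MeasureTheory.measure_mono ?_)
      rw [himage]
      rintro _ ⟨y, hy, rfl⟩
      obtain ⟨x, hx, rfl⟩ := intermediate_value_Ioo hcd.le (hcont.iterate n).continuousOn hy
      exact ⟨x, hx, rfl⟩
    have hmin := (ENNReal.ofReal_lt_ofReal_iff (lt_min hε one_pos)).1 (hlow.trans_lt hn)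
    have hdist : F^[n] d - F^[n] c < ε := by
      by_contra! hge
      exact hmin.not_ge (min_le_min_right 1 hge)
    have := hsmall _ _ (hmono.iterate n hcd.le) hdist
    rw [hiter, hiter] at this
    linarith
  tfae_have 1 → 3 := fun h1 => hA3 (h1A h1)
  tfae_have 3 → 4 := h34
  tfae_have 4 → 2 := fun h4 => hA2 (h4A h4)
  tfae_have 2 → 1 := h21
  tfae_finish
end

section
/- Let f : S¹ → S¹ be a continuous, non-decreasing, degree-one circle map with irrational rotation number, and suppose f is constant on a non-degenerate arc U ⊂ S¹. Then the images of U never return to U: for every integer m ≥ 1, f^m(U) ∩ U = ∅. -/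
open Filter Topology Set

/-- If `f` is a continuous, non-decreasing, degree-one circle map with
irrational rotation number which is constant on a non-degenerate arc `U`, then the
forward images of `U` never return to `U`: `f^m(U) ∩ U = ∅` for all `m ≥ 1`. -/
theorem flat_arc_never_returns
    (f : AddCircle (1:ℝ) → AddCircle (1:ℝ)) (F : ℝ → ℝ) (ρ a b : ℝ)
    (hmono : Monotone F) (hcont : Continuous F)
    (hdeg : ∀ x : ℝ, F (x + 1) = F x + 1)
    (hlift : ∀ x : ℝ, f (x : AddCircle (1:ℝ)) = ((F x : ℝ) : AddCircle (1:ℝ)))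
    (hρirr : Irrational ρ)
    (hrot : ∀ x : ℝ, Tendsto (fun n : ℕ => F^[n] x / n) atTop (𝓝 ρ))
    (hab : a < b)
    (hconst : ∀ x ∈ Set.Ioo a b, ∀ y ∈ Set.Ioo a b, F x = F y) :
    ∀ m : ℕ, 1 ≤ m →
      Disjoint (f^[m] '' ((fun r : ℝ => (r : AddCircle (1:ℝ))) '' Set.Ioo a b))
               ((fun r : ℝ => (r : AddCircle (1:ℝ))) '' Set.Ioo a b) := by
  intro m hm
  rw [Set.disjoint_left]
  rintro _ ⟨_, ⟨x, hx, rfl⟩, rfl⟩ ⟨y, hy, hyx⟩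
  have hsemi : Function.Semiconj (fun r : ℝ => (r : AddCircle (1:ℝ))) F f :=
    fun r => (hlift r).symm
  have hiter : F^[m] y = F^[m] x := by
    obtain ⟨n, rfl⟩ : ∃ n, m = n + 1 := ⟨m - 1, by lia⟩
    rw [Function.iterate_succ_apply, Function.iterate_succ_apply, hconst y hy x hx]
  have hmod : ((F^[m] x - y : ℝ) : AddCircle (1:ℝ)) = 0 := by
    rw [AddCircle.coe_sub, sub_eq_zero]
    exact ((hsemi.iterate_right m).eq x).trans hyx.symm
  obtain ⟨k, hk⟩ := (AddCircle.coe_eq_zero_iff (1:ℝ)).mp hmod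
  rw [zsmul_one] at hk
  let G : CircleDeg1Lift := ⟨⟨F, hmono⟩, hdeg⟩
  have hτ : CircleDeg1Lift.translationNumber G = ρ := by
    refine tendsto_nhds_unique (G.tendsto_translation_number₀) ?_
    simp only [CircleDeg1Lift.coe_pow]
    exact hrot 0
  have hper : (G ^ m) y = y + k := by
    rw [CircleDeg1Lift.coe_pow]
    change F^[m] y = y + k
    linarith
  have hrat := G.translationNumber_of_map_pow_eq_add_int hper hm
  refine hρirr ⟨(k / m : ℚ), ?_⟩
  rw [← hτ, hrat]
  push_cast
  rfl
end
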